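/- In S(F₃;ℂ), with α = g₃g₂⁻¹g₁g₂g₁⁻¹ and β = g₂⁻¹g₁g₂g₁⁻¹g₃, one has Φ(Q) = [αg₂] − [βg₂], where Q = −x₁x₂x₁₂x₂₃ + x₁₂²x₂₃ + x₁²x₂₃ + x₁x₂²x₁₂₃ − x₂x₁₂x₁₂₃ − 2x₁x₁₂₃ − x₁x₂x₁₃ + 2x₁₂x₁₃. -/

import Mathlib

open MvPolynomial

noncomputable section

def skeinIdeal (R G : Type*) [CommRing R] [Group G] : Ideal (MvPolynomial G R) :=
  Ideal.span ({X (1 : G) - 2} ∪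
    {p | ∃ g h : G, p = X g * X h - X (g * h) - X (g * h⁻¹)})

abbrev SkeinAlgebra (R G : Type*) [CommRing R] [Group G] :=
  MvPolynomial G R ⧸ skeinIdeal R G

def cl (R : Type*) {G : Type*} [CommRing R] [Group G] (g : G) : SkeinAlgebra R G :=
  Ideal.Quotient.mk (skeinIdeal R G) (X g)

/-- The free group on three generators. -/
abbrev F3 := FreeGroup (Fin 3)

def g1 : F3 := FreeGroup.of 0
def g2 : F3 := FreeGroup.of 1
def g3 : F3 := FreeGroup.of 2

/-- The words `g₁, g₂, g₃, g₁g₂, g₁g₃, g₂g₃, g₁g₂g₃` indexed by the seven variables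
`x₁, x₂, x₃, x₁₂, x₁₃, x₂₃, x₁₂₃`. -/
def word : Fin 7 → F3 := ![g1, g2, g3, g1 * g2, g1 * g3, g2 * g3, g1 * g2 * g3]

/-- `Φ : ℂ[x₁,…,x₁₂₃] → S(F₃;ℂ)`, `x_{i₁⋯i_k} ↦ [g_{i₁}⋯g_{i_k}]`. -/
def Phi : MvPolynomial (Fin 7) ℂ →ₐ[ℂ] SkeinAlgebra ℂ F3 :=
  aeval fun i => cl ℂ (word i)

-- the seven variables
def x1 : MvPolynomial (Fin 7) ℂ := X 0
def x2 : MvPolynomial (Fin 7) ℂ := X 1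
def x3 : MvPolynomial (Fin 7) ℂ := X 2
def x12 : MvPolynomial (Fin 7) ℂ := X 3
def x13 : MvPolynomial (Fin 7) ℂ := X 4
def x23 : MvPolynomial (Fin 7) ℂ := X 5
def x123 : MvPolynomial (Fin 7) ℂ := X 6

/-- The polynomial `K`. -/
def K : MvPolynomial (Fin 7) ℂ :=
  x123 ^ 2 - (x12 * x3 + x13 * x2 + x23 * x1 - x1 * x2 * x3) * x123
    + x1 ^ 2 + x2 ^ 2 + x3 ^ 2 + x12 ^ 2 + x23 ^ 2 + x13 ^ 2
    - x1 * x2 * x12 - x1 * x3 * x13 - x2 * x3 * x23 + x12 * x13 * x23 - 4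

def ralpha : F3 := g3 * g2⁻¹ * g1 * g2 * g1⁻¹
def rbeta : F3 := g2⁻¹ * g1 * g2 * g1⁻¹ * g3

def Q : MvPolynomial (Fin 7) ℂ :=
  -(x1*x2*x12*x23) + x12^2*x23 + x1^2*x23 + x1*x2^2*x123 - x2*x12*x123
    - 2*x1*x123 - x1*x2*x13 + 2*x12*x13

section Skein

variable {R G : Type*} [CommRing R] [Group G]

lemma cl_one : cl R (1 : G) = 2 := by
  have h : Ideal.Quotient.mk (skeinIdeal R G) (X 1) = Ideal.Quotient.mk (skeinIdeal R G) 2 :=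
    Ideal.Quotient.eq.mpr (Ideal.subset_span (Or.inl rfl))
  exact h.trans (map_ofNat _ 2)

lemma cl_mul_cl (g h : G) : cl R g * cl R h = cl R (g * h) + cl R (g * h⁻¹) := by
  have hmk := Ideal.Quotient.eq_zero_iff_mem.mpr
    (show X g * X h - X (g * h) - X (g * h⁻¹) ∈ skeinIdeal R G from
      Ideal.subset_span (Or.inr ⟨g, h, rfl⟩))
  simp only [map_sub, map_mul] at hmk
  unfold cl
  linear_combination hmk

lemma cl_mul_inv (g h : G) : cl R (g * h⁻¹) = cl R g * cl R h - cl R (g * h) := by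
  rw [cl_mul_cl]
  ring

lemma cl_inv (g : G) : cl R g⁻¹ = cl R g := by
  have h := cl_mul_inv (R := R) 1 g
  simp only [one_mul, cl_one] at h
  linear_combination h

lemma cl_mul_comm (g h : G) : cl R (g * h) = cl R (h * g) := by
  have hi := cl_inv (R := R) (g * h⁻¹)
  rw [mul_inv_rev, inv_inv, cl_mul_inv, cl_mul_inv] at hi
  linear_combination hi

/-- The linear relation between the two cyclic orders of a product of three elements. -/
lemma cl_mul_mul_add (a b c : G) :
    cl R (a * b * c) + cl R (a * c * b) =
      cl R (a * b) * cl R c + cl R (a * c) * cl R b + cl R (b * c) * cl R a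
        - cl R a * cl R b * cl R c := by
  have h₁ := cl_mul_cl (R := R) a (b * c)
  have h₂ := cl_mul_inv (R := R) (a * c⁻¹) b
  have h₃ := cl_mul_inv (R := R) a c
  have h₄ := cl_mul_inv (R := R) (b * a) c
  rw [mul_inv_rev, ← mul_assoc, ← mul_assoc] at h₁
  rw [cl_mul_comm (a * c⁻¹) b, ← mul_assoc] at h₂
  rw [cl_mul_comm b a, mul_assoc b a c, cl_mul_comm b (a * c)] at h₄
  linear_combination -h₁ - h₂ - cl R b * h₃ + h₄

/-- The class of `a b a⁻¹ c` in terms of classes of positive words. -/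
lemma cl_mul_mul_inv_mul (a b c : G) :
    cl R (a * b * a⁻¹ * c) =
      cl R (a * b * c) * cl R a - cl R (a * c) * cl R (a * b)
        + cl R b * cl R c - cl R (b * c) := by
  have h₁ := cl_mul_inv (R := R) (c * a * b) a
  have h₂ := cl_mul_cl (R := R) (a * c) (a * b)
  have h₃ := cl_mul_inv (R := R) c b
  have e₁ : cl R (c * a * b * a⁻¹) = cl R (a * b * a⁻¹ * c) := by
    rw [mul_assoc c, mul_assoc c, cl_mul_comm c]
  have e₀ : cl R (c * a * b) = cl R (a * b * c) := by
    rw [mul_assoc, cl_mul_comm]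
  have e₂ : cl R (c * a * b * a) = cl R (a * c * (a * b)) := by
    rw [cl_mul_comm (c * a * b) a]
    simp only [mul_assoc]
  have e₃ : cl R (a * c * (a * b)⁻¹) = cl R (c * b⁻¹) := by
    rw [mul_assoc a, cl_mul_comm a]
    congr 1
    group
  rw [e₁, e₂, e₀] at h₁
  rw [e₃] at h₂
  rw [cl_mul_comm c b] at h₃
  linear_combination h₁ + h₂ + h₃

/-- The class of `c b⁻¹ a b a⁻¹ b` in terms of classes of positive words. -/
lemma cl_mul_inv_mul_mul_inv_mul (a b c : G) :
    cl R (c * b⁻¹ * a * b * a⁻¹ * b) =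
      (cl R (a * b * c) * cl R b - cl R (a * b) * cl R (b * c) + cl R a * cl R c
          - cl R (a * c)) * (cl R a * cl R b - cl R (a * b))
        - (cl R (a * c) * cl R b - cl R (a * c * b)) * cl R a
        + cl R b * cl R c - cl R (b * c) := by
  have h₁ := cl_mul_cl (R := R) (c * b⁻¹ * a * b) (b⁻¹ * a)
  have h₂ := cl_mul_cl (R := R) (c * b⁻¹ * a) a
  have h₃ := cl_mul_inv (R := R) c b
  have h₄ := cl_mul_inv (R := R) (a * c) b
  have h₅ := cl_mul_inv (R := R) (a * b * c) b
  have h₆ := cl_mul_cl (R := R) (a * b) (c * b)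
  have h₇ := cl_mul_inv (R := R) a c
  have h₈ := cl_mul_inv (R := R) a b
  have e₁ : c * b⁻¹ * a * b * (b⁻¹ * a)⁻¹ = c * b⁻¹ * a * b * a⁻¹ * b := by group
  have e₂ : c * b⁻¹ * a * b * (b⁻¹ * a) = c * b⁻¹ * a * a := by group
  have e₃ : cl R (c * b⁻¹ * a) = cl R (a * c * b⁻¹) := by
    rw [cl_mul_comm _ a, mul_assoc a]
  have e₄ : cl R (c * b⁻¹ * a * b) = cl R (a * b * c * b⁻¹) := by
    rw [mul_assoc (c * b⁻¹), cl_mul_comm, ← mul_assoc]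
  have e₅ : a * b * (c * b)⁻¹ = a * c⁻¹ := by group
  rw [e₁, e₂, e₄, cl_mul_comm b⁻¹ a] at h₁
  rw [mul_inv_cancel_right, e₃] at h₂
  rw [← mul_assoc (a * b), e₅, cl_mul_comm c b] at h₆
  rw [cl_mul_comm c b] at h₃
  linear_combination -h₁ + h₂ + h₃ - cl R a * h₄ + cl R (a * b⁻¹) * (h₅ + h₆ + h₇)
    + (cl R (a * b * c) * cl R b - cl R (a * b) * cl R (b * c) + cl R a * cl R c
          - cl R (a * c)) * h₈

end Skein

theorem phi_Q_alpha_g2 : Phi Q = cl ℂ (ralpha * g2) - cl ℂ (rbeta * g2) := by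
  have hb : cl ℂ (rbeta * g2) = cl ℂ (g1 * g2 * g1⁻¹ * g3) := by
    rw [rbeta, mul_assoc g2⁻¹, mul_assoc g2⁻¹, mul_assoc g2⁻¹, mul_assoc g2⁻¹,
      cl_mul_comm g2⁻¹, mul_inv_cancel_right]
  have hs := cl_mul_mul_add (R := ℂ) g1 g2 g3
  rw [hb, ralpha, cl_mul_inv_mul_mul_inv_mul, cl_mul_mul_inv_mul]
  simp only [Q, Phi, x1, x2, x12, x13, x23, x123, map_add, map_sub, map_neg, map_mul, map_pow,
    map_ofNat, aeval_X, word]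
  simp only [Matrix.cons_val]
  linear_combination (-cl ℂ g1) * hs
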